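/- arXiv:0801.0449 — 2 statements merged into one kernel-verified Lean document; each statement's English description precedes it below -/
import Mathlib

section
/- Let A be a regular local ring of dimension n containing a field (equicharacteristic), with maximal ideal m_A and fraction field K. Let ν be a real-valued (rank one) valuation on K dominating A, and let s₀ = min{ν(f) : f ∈ m_A, f ≠ 0} (assume this minimum exists, i.e., s₀ = ν(g) for some nonzero g ∈ m_A and s₀ ≤ ν(f) for all nonzero f ∈ m_A). Then for every natural number d, the set ν(m_A ∖ {0}) ∩ [0, (d+1)s₀) has fewer than (n+d choose n) elements. -/
open IsLocalRing in
/-- If `J` is generated by a family indexed by `ι`, then passing from `A ⧸ J` to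
`A ⧸ 𝔪J` raises the length by at most the cardinality of `ι`. -/
theorem length_quotient_maximalIdeal_mul_le {A ι : Type*} [CommRing A] [IsLocalRing A] [Fintype ι]
    (g : ι → A) {J : Ideal A} (hJ : J = Ideal.span (Set.range g)) :
    Module.length A (A ⧸ (maximalIdeal A * J)) ≤ Module.length A (A ⧸ J) + Fintype.card ι := by
  classical
  set N : Ideal A := maximalIdeal A * J
  have hNJ : N ≤ J := Ideal.mul_le_right
  have hker (i : ι) : maximalIdeal A ≤ LinearMap.ker (LinearMap.toSpanSingleton A (A ⧸ N)
      (Submodule.Quotient.mk (g i))) := by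
    intro a ha
    rw [LinearMap.mem_ker, LinearMap.toSpanSingleton_apply, ← Submodule.Quotient.mk_smul,
      Submodule.Quotient.mk_eq_zero, smul_eq_mul]
    exact Ideal.mul_mem_mul ha (hJ ▸ Ideal.subset_span (Set.mem_range_self i))
  let φ : (ι → A ⧸ maximalIdeal A) →ₗ[A] A ⧸ N :=
    LinearMap.lsum A (fun _ => A ⧸ maximalIdeal A) ℕ fun i =>
      Submodule.liftQ (maximalIdeal A) (LinearMap.toSpanSingleton A (A ⧸ N)
        (Submodule.Quotient.mk (g i))) (hker i)
  let π : (A ⧸ N) →ₗ[A] A ⧸ J := Submodule.factor hNJ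
  have hle : LinearMap.ker π ≤ LinearMap.range φ := by
    intro y hy
    obtain ⟨a, rfl⟩ := Submodule.Quotient.mk_surjective N y
    have ha : a ∈ J := (Submodule.Quotient.mk_eq_zero J).1 (LinearMap.mem_ker.1 hy)
    rw [hJ] at ha
    obtain ⟨c, rfl⟩ := (Submodule.mem_span_range_iff_exists_fun A).1 ha
    refine ⟨fun i => Submodule.Quotient.mk (c i), ?_⟩
    rw [← Submodule.mkQ_apply, map_sum]
    simp only [φ, LinearMap.lsum_apply, LinearMap.sum_apply, LinearMap.comp_apply,
      LinearMap.proj_apply]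
    exact Finset.sum_congr rfl fun i _ => rfl
  have hsimple : IsSimpleModule A (A ⧸ maximalIdeal A) :=
    isSimpleModule_iff_isCoatom.2 (maximalIdeal.isMaximal A).out
  have hφ : Module.length A (LinearMap.range φ) ≤ Fintype.card ι := by
    refine (Module.length_le_of_surjective φ.rangeRestrict φ.surjective_rangeRestrict).trans ?_
    rw [Module.length_pi, Module.length_eq_one]
    simp
  rw [Module.length_eq_add_of_exact (LinearMap.ker π).subtype π (Submodule.subtype_injective _)
    (Submodule.factor_surjective hNJ) (LinearMap.exact_subtype_ker_map π), add_comm]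
  gcongr
  exact (Module.length_le_of_injective _ (Submodule.inclusion_injective hle)).trans hφ

/-- The `d`-th power of an ideal is spanned by the degree `d` monomials in its generators. -/
theorem span_pow_eq_span_range_sym_prod {A : Type*} [CommSemiring A] (s : Finset A) (d : ℕ) :
    Ideal.span (s : Set A) ^ d =
      Ideal.span (Set.range fun x : Sym s d => (x.1.map Subtype.val).prod) := by
  rw [Ideal.span, Submodule.span_pow]
  congr 1
  ext a
  rw [Set.mem_pow_iff_prod]
  constructor
  · rintro ⟨f, hf, rfl⟩
    refine ⟨⟨Finset.univ.val.map fun i => ⟨f i, hf i⟩, by simp⟩, ?_⟩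
    simp [Finset.prod, Function.comp_def]
  · rintro ⟨⟨x, rfl⟩, rfl⟩
    induction x using Quotient.inductionOn with
    | h l =>
      exact ⟨fun i => (l.get i).1, fun i => (l.get i).2, Fin.prod_univ_fun_getElem l Subtype.val⟩

open IsLocalRing in
/-- In a local ring whose maximal ideal has `n` generators, `A ⧸ 𝔪 ^ (d + 1)` has length at most
`(n + d).choose n`. -/
theorem length_quotient_maximalIdeal_pow_succ_le {A : Type*} [CommRing A] [IsLocalRing A]
    {s : Finset A} (hs : Ideal.span (s : Set A) = maximalIdeal A) (d : ℕ) :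
    Module.length A (A ⧸ maximalIdeal A ^ (d + 1)) ≤ ((s.card + d).choose s.card : ℕ) := by
  classical
  have key (d : ℕ) : Module.length A (A ⧸ maximalIdeal A ^ d) ≤
      ((∑ i ∈ Finset.range d, s.card.multichoose i : ℕ) : ℕ∞) := by
    induction d with
    | zero =>
      have : Subsingleton (A ⧸ maximalIdeal A ^ 0) :=
        Ideal.Quotient.subsingleton_iff.2 (by simp)
      simp
    | succ d ih =>
      have hJ := span_pow_eq_span_range_sym_prod s d
      rw [hs] at hJ
      have h := length_quotient_maximalIdeal_mul_le _ hJ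
      rw [Sym.card_sym_eq_multichoose, Fintype.card_coe, ← pow_succ'] at h
      rw [Finset.sum_range_succ, Nat.cast_add]
      exact h.trans (by gcongr)
  refine (key (d + 1)).trans_eq ?_
  rw [Nat.sum_range_multichoose, add_comm]

/-- A strictly antitone family of ideals, all containing `I`, indexed by a finite set of reals has
at most `length (A ⧸ I) + 1` members. -/
theorem card_le_length_quotient_add_one {A : Type*} [CommRing A] (I : Ideal A) (T : Finset ℝ)
    (J : ℝ → Ideal A) (hJ : StrictAntiOn J T) (hI : ∀ x ∈ T, I ≤ J x) :
    (T.card : ℕ∞) ≤ Module.length A (A ⧸ I) + 1 := by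
  rcases hT : T.card with _ | N
  · simp
  let e := T.orderEmbOfFin hT
  let p : LTSeries (Ideal A) := LTSeries.mk N (fun i => J (e i.rev)) fun i j hij =>
    hJ (T.orderEmbOfFin_mem hT _) (T.orderEmbOfFin_mem hT _)
      (e.strictMono (Fin.rev_lt_rev.2 hij))
  rw [Module.length_quotient, Nat.cast_add, Nat.cast_one]
  gcongr
  exact Order.length_le_coheight (p := p) (hI _ (T.orderEmbOfFin_mem hT _))


/-- **Corollary 1 of the paper.** Let `A` be an equicharacteristic regular local
ring of dimension `n` (a noetherian local ring whose maximal ideal is generated by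
`n = dim A` elements) with maximal ideal `m_A` and fraction field `K`, and let `ν` be a
real-valued (rank one) valuation on `K` dominating `A`, with
`s₀ = min {ν f : f ∈ m_A, f ≠ 0}` (assumed to exist).  Then for every natural number `d`, the
set `ν(m_A ∖ {0}) ∩ [0, (d+1)s₀)` has fewer than `(n+d).choose n` elements. -/
theorem card_values_lt_choose_regular_local
    {A : Type*} [CommRing A] [IsDomain A] [IsNoetherianRing A] [IsLocalRing A]
    (hequichar : ∃ k : Subring A, IsField k)
    (n : ℕ) (hdim : ringKrullDim A = n)
    (hreg : ∃ s : Finset A, s.card = n ∧ Ideal.span (s : Set A) = IsLocalRing.maximalIdeal A)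
    (ν : FractionRing A → ℝ)
    (hmul : ∀ x y : FractionRing A, x ≠ 0 → y ≠ 0 → ν (x * y) = ν x + ν y)
    (hadd : ∀ x y : FractionRing A, x ≠ 0 → y ≠ 0 → x + y ≠ 0 → min (ν x) (ν y) ≤ ν (x + y))
    (hdom : ∀ a : A, a ≠ 0 →
      0 ≤ ν (algebraMap A (FractionRing A) a) ∧
      (0 < ν (algebraMap A (FractionRing A) a) ↔ a ∈ IsLocalRing.maximalIdeal A))
    (s₀ : ℝ)
    (hg : ∃ g ∈ IsLocalRing.maximalIdeal A, g ≠ 0 ∧ ν (algebraMap A (FractionRing A) g) = s₀)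
    (hmin : ∀ f ∈ IsLocalRing.maximalIdeal A, f ≠ 0 →
      s₀ ≤ ν (algebraMap A (FractionRing A) f))
    (d : ℕ) :
    ({x : ℝ | ∃ f ∈ IsLocalRing.maximalIdeal A, f ≠ 0 ∧
        ν (algebraMap A (FractionRing A) f) = x}
      ∩ Set.Ico 0 ((d + 1 : ℝ) * s₀)).Finite ∧
    ({x : ℝ | ∃ f ∈ IsLocalRing.maximalIdeal A, f ≠ 0 ∧
        ν (algebraMap A (FractionRing A) f) = x}
      ∩ Set.Ico 0 ((d + 1 : ℝ) * s₀)).ncard < (n + d).choose n := by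
  classical
  obtain ⟨s, rfl, hs⟩ := hreg
  obtain ⟨g, hgm, hg0, hgv⟩ := hg
  set m := IsLocalRing.maximalIdeal A
  set v : A → ℝ := fun a => ν (algebraMap A (FractionRing A) a) with hv
  have hne {a : A} (ha : a ≠ 0) : algebraMap A (FractionRing A) a ≠ 0 := by simpa using ha
  have hvmul {a b : A} (ha : a ≠ 0) (hb : b ≠ 0) : v (a * b) = v a + v b := by
    simpa [hv] using hmul _ _ (hne ha) (hne hb)
  have hvadd {a b : A} (ha : a ≠ 0) (hb : b ≠ 0) (hab : a + b ≠ 0) :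
      min (v a) (v b) ≤ v (a + b) := by
    simpa [hv] using hadd _ _ (hne ha) (hne hb) (by simpa using hne hab)
  have hs₀ : 0 < s₀ := hgv ▸ (hdom g hg0).2.2 hgm
  have hv1 : v 1 = 0 := by
    have := hvmul (one_ne_zero (α := A)) one_ne_zero
    rw [mul_one] at this
    linarith
  let J (x : ℝ) : Ideal A :=
    { carrier := {a | a ≠ 0 → x ≤ v a}
      zero_mem' := fun h => absurd rfl h
      add_mem' := fun {a b} ha hb hab => by
        by_cases ha0 : a = 0
        · simp only [ha0, zero_add] at hab ⊢
          exact hb hab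
        by_cases hb0 : b = 0
        · simp only [hb0, add_zero] at hab ⊢
          exact ha hab
        exact (le_min (ha ha0) (hb hb0)).trans (hvadd ha0 hb0 hab)
      smul_mem' := fun c a ha hca => by
        rw [smul_eq_mul] at hca ⊢
        rw [hvmul (left_ne_zero_of_mul hca) (right_ne_zero_of_mul hca)]
        exact (ha (right_ne_zero_of_mul hca)).trans
          (le_add_of_nonneg_left (hdom c (left_ne_zero_of_mul hca)).1) }
  have hJanti : Antitone J := fun x y hxy a ha ha0 => hxy.trans (ha ha0)
  have hpow (k : ℕ) : m ^ k ≤ J (k * s₀) := by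
    induction k with
    | zero => exact fun a _ ha0 => by simpa using (hdom a ha0).1
    | succ k ih =>
      rw [pow_succ, Ideal.mul_le]
      intro a ha b hb hab
      rw [hvmul (left_ne_zero_of_mul hab) (right_ne_zero_of_mul hab)]
      have h₁ := ih ha (left_ne_zero_of_mul hab)
      have h₂ := hmin b hb (right_ne_zero_of_mul hab)
      push_cast
      linarith
  set V : Set ℝ := {x : ℝ | ∃ f ∈ m, f ≠ 0 ∧ v f = x} ∩ Set.Ico 0 ((d + 1 : ℝ) * s₀)
  have hpos : 0 < (d + 1 : ℝ) * s₀ := by positivity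
  have hcard (S : Finset ℝ) (hS : (S : Set ℝ) ⊆ V) : S.card < (s.card + d).choose s.card := by
    have hval {x : ℝ} (hx : x ∈ insert 0 S) : x < (d + 1 : ℝ) * s₀ ∧ ∃ f, f ≠ 0 ∧ v f = x := by
      rcases Finset.mem_insert.1 hx with rfl | hx
      · exact ⟨hpos, 1, one_ne_zero, hv1⟩
      · obtain ⟨⟨f, -, hf0, hf⟩, -, hlt⟩ := hS hx
        exact ⟨hlt, f, hf0, hf⟩
    have hzero : (0 : ℝ) ∉ S := fun h => by
      obtain ⟨⟨f, hfm, hf0, hf⟩, -⟩ := hS h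
      exact (hf ▸ (hdom f hf0).2.2 hfm).false
    have htop : (d + 1 : ℝ) * s₀ ∉ insert 0 S := fun h => (hval h).1.false
    have hle {x : ℝ} (hx : x ∈ insert ((d + 1 : ℝ) * s₀) (insert 0 S)) :
        x ≤ (d + 1 : ℝ) * s₀ := by
      rcases Finset.mem_insert.1 hx with rfl | hx
      · exact le_rfl
      · exact (hval hx).1.le
    have hlen := card_le_length_quotient_add_one (m ^ (d + 1))
      (insert ((d + 1 : ℝ) * s₀) (insert 0 S)) J
      (fun x hx y hy hxy => by
        obtain ⟨f, hf0, hf⟩ := (hval (Finset.mem_of_mem_insert_of_ne hx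
          (hxy.trans_le (hle hy)).ne)).2
        refine lt_of_le_of_ne (hJanti hxy.le) fun h => ?_
        have hfx : f ∈ J x := fun _ => hf.ge
        rw [← h] at hfx
        exact absurd (hfx hf0) (by rw [hf]; exact hxy.not_ge))
      (fun x hx => (hpow (d + 1)).trans (hJanti (by push_cast; exact hle hx)))
    have hbound := hlen.trans (add_le_add_left (length_quotient_maximalIdeal_pow_succ_le hs d) 1)
    rw [Finset.card_insert_of_notMem htop, Finset.card_insert_of_notMem hzero] at hbound
    norm_cast at hbound
    lia
  have hfin : V.Finite := by
    by_contra hinf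
    obtain ⟨S, hS, hSc⟩ := Set.Infinite.exists_subset_card_eq hinf ((s.card + d).choose s.card)
    exact (hcard S hS).ne hSc
  refine ⟨hfin, ?_⟩
  rw [Set.ncard_eq_toFinset_card V hfin]
  exact hcard _ (by simp)
end

section
/- There exists an additive subsemigroup U of ℚ consisting of positive elements, with U ∩ [0, r) finite for every rational r (so that U is well-ordered of ordinal type ω), such that for every noetherian local domain A containing a field (equicharacteristic), with maximal ideal m_A and fraction field K, and every real-valued (rank one) valuation ν on K dominating A, the set ν(m_A ∖ {0}) is not equal to the image of U in ℝ. -/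
open scoped Pointwise

/-- A submodule spanned by a finite set and annihilated by a maximal ideal has length at most the
number of generators. -/
lemma length_le_card_of_span_of_smul_eq_zero {R M : Type*} [CommRing R] [AddCommGroup M]
    [Module R M] (I : Ideal R) [I.IsMaximal] (t : Finset M)
    (ht : ∀ a ∈ I, ∀ x ∈ t, a • x = 0) :
    Module.length R (Submodule.span R (t : Set M)) ≤ t.card := by
  classical
  let G : (t → R ⧸ I) →ₗ[R] M := ∑ x : t,
    (Submodule.liftQ I (LinearMap.toSpanSingleton R M x.1) fun a ha => by
      simpa using ht a ha x.1 x.2) ∘ₗ LinearMap.proj x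
  have hG : Submodule.span R (t : Set M) ≤ LinearMap.range G := by
    rw [Submodule.span_le]
    intro x hx
    refine ⟨Pi.single ⟨x, hx⟩ (Submodule.Quotient.mk 1), ?_⟩
    simp only [G, LinearMap.sum_apply, LinearMap.comp_apply, LinearMap.proj_apply]
    rw [Finset.sum_eq_single ⟨x, hx⟩]
    · rw [Pi.single_eq_same, Submodule.liftQ_apply]
      simp
    · intro y _ hy
      rw [Pi.single_eq_of_ne hy, map_zero]
    · simp
  have : IsSimpleModule R (R ⧸ I) :=
    isSimpleModule_iff_isCoatom.mpr (Ideal.isMaximal_def.mp inferInstance)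
  calc Module.length R (Submodule.span R (t : Set M))
      ≤ Module.length R (LinearMap.range G) :=
        Module.length_le_of_injective (Submodule.inclusion hG) (Submodule.inclusion_injective hG)
    _ ≤ Module.length R (t → R ⧸ I) :=
        Module.length_le_of_surjective G.rangeRestrict G.surjective_rangeRestrict
    _ = t.card := by simp

/-- If a maximal ideal `I` has `d` generators, then `R ⧸ I ^ n` has length at most
`(d + 2) ^ n`. -/
lemma length_quotient_pow_le {R : Type*} [CommRing R] (s : Finset R)
    [(Ideal.span (s : Set R)).IsMaximal] (n : ℕ) :
    Module.length R (R ⧸ Ideal.span (s : Set R) ^ n) ≤ ((s.card + 2) ^ n : ℕ) := by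
  classical
  set I := Ideal.span (s : Set R) with hI
  induction n with
  | zero =>
    rw [pow_zero, Ideal.one_eq_top]
    have : Subsingleton (R ⧸ (⊤ : Ideal R)) := Ideal.Quotient.subsingleton_iff.mpr rfl
    rw [Module.length_eq_zero]
    exact zero_le
  | succ n ih =>
    have hle : I ^ (n + 1) ≤ I ^ n := Ideal.pow_le_pow_right n.le_succ
    have hspan : I ^ n = Submodule.span R (s ^ n : Finset R) := by
      rw [hI, Ideal.span, Submodule.span_pow, Finset.coe_pow]
    have hker : LinearMap.ker (Submodule.factor hle) =
        Submodule.span R (((s ^ n).image (I ^ (n + 1)).mkQ : Finset _) : Set _) := by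
      rw [Submodule.factor, Submodule.ker_mapQ, Submodule.comap_id, Finset.coe_image,
        ← Submodule.map_span, ← hspan]
    rw [Module.length_eq_add_of_exact (LinearMap.ker (Submodule.factor hle)).subtype
      (Submodule.factor hle) (Submodule.subtype_injective _) (Submodule.factor_surjective hle)
      (LinearMap.exact_subtype_ker_map _), hker]
    have h1 := length_le_card_of_span_of_smul_eq_zero I ((s ^ n).image (I ^ (n + 1)).mkQ) (by
      intro a ha x hx
      obtain ⟨y, hy, rfl⟩ := Finset.mem_image.mp hx
      rw [← map_smul, Submodule.mkQ_apply, Submodule.Quotient.mk_eq_zero, smul_eq_mul, pow_succ']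
      refine Ideal.mul_mem_mul ha ?_
      rw [hspan]
      exact Submodule.subset_span hy)
    refine (add_le_add h1 ih).trans ?_
    have h2 : ((s ^ n).image (I ^ (n + 1)).mkQ).card ≤ (s.card + 2) ^ n :=
      Finset.card_image_le.trans <| Finset.card_pow_le.trans <|
        Nat.pow_le_pow_left (Nat.le_add_right _ _) n
    have h3 : ((s ^ n).image (I ^ (n + 1)).mkQ).card + (s.card + 2) ^ n ≤
        (s.card + 2) ^ (n + 1) := by
      rw [pow_succ (s.card + 2)]
      nlinarith [Nat.zero_le ((s.card + 2) ^ n * s.card)]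
    exact_mod_cast h3

/-- The ideal of elements of value at least `r`, for a function `v` that is additive on products
and satisfies the ultrametric inequality on nonzero elements. -/
def valueIdeal {A : Type*} [CommRing A] [IsDomain A] (v : A → ℝ)
    (hmul : ∀ a b, a ≠ 0 → b ≠ 0 → v (a * b) = v a + v b)
    (hadd : ∀ a b, a ≠ 0 → b ≠ 0 → a + b ≠ 0 → min (v a) (v b) ≤ v (a + b))
    (hnonneg : ∀ a, a ≠ 0 → 0 ≤ v a) (r : ℝ) : Ideal A where
  carrier := {f | f ≠ 0 → r ≤ v f}
  zero_mem' h := absurd rfl h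
  add_mem' {a b} ha hb hab := by
    by_cases ha0 : a = 0
    · subst ha0
      rw [zero_add] at hab ⊢
      exact hb hab
    by_cases hb0 : b = 0
    · subst hb0
      rw [add_zero] at hab ⊢
      exact ha hab
    exact (le_min (ha ha0) (hb hb0)).trans (hadd a b ha0 hb0 hab)
  smul_mem' c x hx hcx := by
    rw [smul_eq_mul] at hcx ⊢
    have hc0 := left_ne_zero_of_mul hcx
    have hx0 := right_ne_zero_of_mul hcx
    rw [hmul c x hc0 hx0]
    linarith [hnonneg c hc0, hx hx0]

/-- For a noetherian local domain all of whose nonunits have value at least `1`, the number of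
values below `n` grows at most exponentially in `n`. -/
lemma exists_card_values_le_pow {A : Type*} [CommRing A] [IsDomain A] [IsNoetherianRing A]
    [IsLocalRing A] (v : A → ℝ)
    (hmul : ∀ a b, a ≠ 0 → b ≠ 0 → v (a * b) = v a + v b)
    (hadd : ∀ a b, a ≠ 0 → b ≠ 0 → a + b ≠ 0 → min (v a) (v b) ≤ v (a + b))
    (hnonneg : ∀ a, a ≠ 0 → 0 ≤ v a)
    (hone : ∀ a ∈ IsLocalRing.maximalIdeal A, a ≠ 0 → 1 ≤ v a) :
    ∃ d : ℕ, ∀ (n k : ℕ) (x : ℕ → ℝ), StrictMono x → x k ≤ n →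
      (∀ j < k, ∃ f, f ≠ 0 ∧ v f = x j) → k ≤ (d + 2) ^ n := by
  obtain ⟨s, hs⟩ := IsNoetherian.noetherian (IsLocalRing.maximalIdeal A)
  have hmax : (Ideal.span (s : Set A)).IsMaximal := by
    rw [Ideal.span, hs]
    infer_instance
  refine ⟨s.card, fun n k x hx hxn hf => ?_⟩
  let P := valueIdeal v hmul hadd hnonneg
  have hpow : ∀ n : ℕ, Ideal.span (s : Set A) ^ n ≤ P n := by
    intro n
    induction n with
    | zero => exact fun a _ ha => by simpa using hnonneg a ha
    | succ n ih =>
      rw [pow_succ, Ideal.mul_le]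
      intro a ha b hb hab
      have ha0 := left_ne_zero_of_mul hab
      have hb0 := right_ne_zero_of_mul hab
      have h1 : (n : ℝ) ≤ v a := ih ha ha0
      have h2 := hone b (hs ▸ hb) hb0
      rw [hmul a b ha0 hb0]
      push_cast
      linarith
  have hlt : ∀ i j : ℕ, j < i → i ≤ k → P (x i) < P (x j) := by
    intro i j hji hik
    refine lt_of_le_of_ne (fun a ha ha0 => (hx hji).le.trans (ha ha0)) fun h => ?_
    obtain ⟨f, hf0, hfv⟩ := hf j (hji.trans_le hik)
    have h1 : f ∈ P (x j) := fun _ => hfv.ge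
    rw [← h] at h1
    exact (hfv ▸ h1 hf0).not_gt (hx hji)
  let p : LTSeries (Ideal A) := LTSeries.mk k (fun i => P (x (k - i))) (by
    intro i j hij
    have : (i : ℕ) < j := hij
    have := j.2
    exact hlt _ _ (by omega) (Nat.sub_le _ _))
  have hp : Ideal.span (s : Set A) ^ n ≤ p.head := (hpow n).trans fun a ha ha0 => by
    simpa using hxn.trans (ha ha0)
  have h1 := Order.length_le_coheight hp
  rw [← Module.length_quotient] at h1
  have h2 := h1.trans (length_quotient_pow_le s n)
  exact_mod_cast h2

/-- The rationals that are at least `n` with denominator dividing `2 ^ n ^ 2`, for some positive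
integer `n`. -/
def dyadicSemigroup : AddSubsemigroup ℚ where
  carrier := {u | ∃ n a : ℕ, 1 ≤ n ∧ (n : ℚ) ≤ u ∧ u * 2 ^ n ^ 2 = a}
  add_mem' := by
    rintro u w ⟨n, a, hn, hnu, ha⟩ ⟨m, b, hm, hmw, hb⟩
    have hn1 : (1 : ℚ) ≤ n := by exact_mod_cast hn
    have hm1 : (1 : ℚ) ≤ m := by exact_mod_cast hm
    rcases le_total n m with h | h
    · obtain ⟨c, hc⟩ := Nat.exists_eq_add_of_le (Nat.pow_le_pow_left h 2)
      refine ⟨m, a * 2 ^ c + b, hm, by linarith, ?_⟩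
      rw [add_mul, hb, hc, pow_add, ← mul_assoc, ha]
      push_cast
      ring
    · obtain ⟨c, hc⟩ := Nat.exists_eq_add_of_le (Nat.pow_le_pow_left h 2)
      refine ⟨n, a + b * 2 ^ c, hn, by linarith, ?_⟩
      rw [add_mul, ha, hc, pow_add, ← mul_assoc, hb]
      push_cast
      ring

lemma mem_dyadicSemigroup {u : ℚ} :
    u ∈ dyadicSemigroup ↔ ∃ n a : ℕ, 1 ≤ n ∧ (n : ℚ) ≤ u ∧ u * 2 ^ n ^ 2 = a :=
  Iff.rfl

lemma one_le_of_mem_dyadicSemigroup {u : ℚ} (hu : u ∈ dyadicSemigroup) : 1 ≤ u := by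
  obtain ⟨n, a, hn, hnu, -⟩ := hu
  exact le_trans (by exact_mod_cast hn) hnu

lemma finite_dyadicSemigroup_lt (r : ℚ) :
    {u : ℚ | u ∈ dyadicSemigroup ∧ 0 ≤ u ∧ u < r}.Finite := by
  obtain ⟨R, hR⟩ := exists_nat_ge r
  refine ((Set.finite_Iic (R * 2 ^ R ^ 2)).image
    fun a : ℕ => (a : ℚ) / 2 ^ R ^ 2).subset ?_
  rintro u ⟨⟨n, a, hn, hnu, ha⟩, -, hur⟩
  have hnR : n ≤ R := by
    have : (n : ℚ) ≤ R := by linarith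
    exact_mod_cast this
  obtain ⟨c, hc⟩ := Nat.exists_eq_add_of_le (Nat.pow_le_pow_left hnR 2)
  have h : u * 2 ^ R ^ 2 = (a * 2 ^ c : ℕ) := by
    rw [hc, pow_add, ← mul_assoc, ha]
    push_cast
    rfl
  refine ⟨a * 2 ^ c, ?_, ?_⟩
  · have h1 : ((a * 2 ^ c : ℕ) : ℚ) ≤ (R * 2 ^ R ^ 2 : ℕ) := by
      rw [← h]
      push_cast
      gcongr
      linarith
    exact_mod_cast h1
  · simp only
    rw [← h]
    field_simp

/-- **Example 2 of the paper, rank one case.** There exists an additive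
subsemigroup `U` of `ℚ` of positive elements, with `U ∩ [0, r)` finite for every rational `r`
(so `U` is well ordered of ordinal type `ω`), such that for every equicharacteristic noetherian
local domain `A` with maximal ideal `m_A` and fraction field `K`, and every real-valued (rank
one) valuation `ν` on `K` dominating `A`, the set `ν(m_A ∖ {0})` is not the image of `U`
in `ℝ`. -/
theorem exists_semigroup_not_value_semigroup :
    ∃ U : AddSubsemigroup ℚ,
      (∀ u ∈ U, (0 : ℚ) < u) ∧
      (∀ r : ℚ, {u : ℚ | u ∈ U ∧ 0 ≤ u ∧ u < r}.Finite) ∧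
      (∀ (A : Type*) (_ : CommRing A) (_ : IsDomain A) (_ : IsNoetherianRing A)
          (_ : IsLocalRing A),
        (∃ k : Subring A, IsField k) →
        ∀ ν : FractionRing A → ℝ,
        (∀ x y : FractionRing A, x ≠ 0 → y ≠ 0 → ν (x * y) = ν x + ν y) →
        (∀ x y : FractionRing A, x ≠ 0 → y ≠ 0 → x + y ≠ 0 → min (ν x) (ν y) ≤ ν (x + y)) →
        (∀ a : A, a ≠ 0 →
          0 ≤ ν (algebraMap A (FractionRing A) a) ∧
          (0 < ν (algebraMap A (FractionRing A) a) ↔ a ∈ IsLocalRing.maximalIdeal A)) →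
        {x : ℝ | ∃ f ∈ IsLocalRing.maximalIdeal A, f ≠ 0 ∧
            ν (algebraMap A (FractionRing A) f) = x}
          ≠ (fun q : ℚ => (q : ℝ)) '' (U : Set ℚ)) := by
  refine ⟨dyadicSemigroup, fun u hu => zero_lt_one.trans_le (one_le_of_mem_dyadicSemigroup hu),
    finite_dyadicSemigroup_lt, ?_⟩
  intro A _ _ _ _ _ ν hmul hadd hdom heq
  have hinj : ∀ a : A, a ≠ 0 → algebraMap A (FractionRing A) a ≠ 0 := fun a ha => by simpa using ha
  obtain ⟨d, hd⟩ := exists_card_values_le_pow (fun a => ν (algebraMap A (FractionRing A) a))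
    (fun a b ha hb => by rw [map_mul, hmul _ _ (hinj a ha) (hinj b hb)])
    (fun a b ha hb hab => by
      rw [map_add]
      exact hadd _ _ (hinj a ha) (hinj b hb) (by rw [← map_add]; exact hinj _ hab))
    (fun a ha => (hdom a ha).1)
    (fun a ha ha0 => by
      have h1 : ν (algebraMap A (FractionRing A) a) ∈
          (fun q : ℚ => (q : ℝ)) '' (dyadicSemigroup : Set ℚ) := heq ▸ ⟨a, ha, ha0, rfl⟩
      obtain ⟨q, hq, hqa⟩ := h1
      simp only at hqa ⊢
      rw [← hqa]
      exact_mod_cast one_le_of_mem_dyadicSemigroup hq)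
  set n := d + 3 with hn
  have h1 := hd (n + 1) (2 ^ n ^ 2) (fun j => ((n + j / 2 ^ n ^ 2 : ℚ) : ℝ))
    (fun i j hij => by
      have : (i : ℚ) < j := by exact_mod_cast hij
      simp only [Rat.cast_lt]
      gcongr)
    (by push_cast; rw [div_self (by positivity)])
    (fun j _ => by
      have h2 : ((n + j / 2 ^ n ^ 2 : ℚ) : ℝ) ∈ {x : ℝ | ∃ f ∈ IsLocalRing.maximalIdeal A, f ≠ 0 ∧
          ν (algebraMap A (FractionRing A) f) = x} := by
        rw [heq]
        refine ⟨_, mem_dyadicSemigroup.mpr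
          ⟨n, n * 2 ^ n ^ 2 + j, by omega, ?_, ?_⟩, rfl⟩
        · have : (0 : ℚ) ≤ j / 2 ^ n ^ 2 := by positivity
          linarith
        · push_cast
          field_simp
      obtain ⟨f, -, hf0, hf⟩ := h2
      exact ⟨f, hf0, hf⟩)
  have h2 : (d + 2) ^ (n + 1) < 2 ^ n ^ 2 := calc
    (d + 2) ^ (n + 1) ≤ (2 ^ (d + 1)) ^ (n + 1) :=
      Nat.pow_le_pow_left (Nat.lt_two_pow_self (n := d + 1)) _
    _ = 2 ^ ((d + 1) * (n + 1)) := (pow_mul _ _ _).symm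
    _ < 2 ^ n ^ 2 := Nat.pow_lt_pow_right one_lt_two (by rw [hn]; nlinarith)
  omega
end
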